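/- The group G is self-replicating: for every finite binary word u and every g ∈ G there exists h ∈ G such that h(u·w) = u·g(w) for all finite binary words w (in particular h fixes u and its section at u equals g). -/

import Mathlib

/-- The tree automorphism `a` as a function: flips the first letter. -/
def aFun : List Bool → List Bool
  | [] => []
  | x :: w => (!x) :: w

mutual
  /-- The tree automorphism `b` as a function. -/
  def bFun : List Bool → List Bool
    | [] => []
    | false :: w => false :: aFun w
    | true :: w => true :: cFun w
  /-- The tree automorphism `c` as a function. -/
  def cFun : List Bool → List Bool
    | [] => []
    | false :: w => false :: bFun w
    | true :: w => true :: w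
end

theorem aFun_involutive : Function.Involutive aFun := by
  intro w
  cases w with
  | nil => rfl
  | cons x t => cases x <;> rfl

theorem bcFun_involutive : ∀ w, bFun (bFun w) = w ∧ cFun (cFun w) = w := by
  intro w
  induction w with
  | nil => exact ⟨rfl, rfl⟩
  | cons x t ih =>
    cases x
    · exact ⟨by simp [bFun, aFun_involutive t], by simp [cFun, ih.1]⟩
    · exact ⟨by simp [bFun, ih.2], by simp [cFun]⟩

/-- The tree automorphism `a` of the binary rooted tree `{0,1}*`. -/
def treeA : Equiv.Perm (List Bool) := Function.Involutive.toPerm aFun aFun_involutive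

/-- The tree automorphism `b` of the binary rooted tree `{0,1}*`. -/
def treeB : Equiv.Perm (List Bool) :=
  Function.Involutive.toPerm bFun (fun w => (bcFun_involutive w).1)

/-- The tree automorphism `c` of the binary rooted tree `{0,1}*`. -/
def treeC : Equiv.Perm (List Bool) :=
  Function.Involutive.toPerm cFun (fun w => (bcFun_involutive w).2)

/-- The group `G = IMG(z²+i)`, the subgroup of `Perm({0,1}*)` generated by `a`, `b`, `c`. -/
def IMG : Subgroup (Equiv.Perm (List Bool)) := Subgroup.closure {treeA, treeB, treeC}

theorem treeA_cons (x : Bool) (w : List Bool) : treeA (x :: w) = (!x) :: w := rfl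

theorem treeB_false_cons (w : List Bool) : treeB (false :: w) = false :: treeA w := by
  change bFun _ = _
  rw [bFun]
  rfl

theorem treeB_true_cons (w : List Bool) : treeB (true :: w) = true :: treeC w := by
  change bFun _ = _
  rw [bFun]
  rfl

theorem treeC_false_cons (w : List Bool) : treeC (false :: w) = false :: treeB w := by
  change cFun _ = _
  rw [cFun]
  rfl

theorem treeA_mem_IMG : treeA ∈ IMG := Subgroup.subset_closure (by simp)

theorem treeB_mem_IMG : treeB ∈ IMG := Subgroup.subset_closure (by simp)

theorem treeC_mem_IMG : treeC ∈ IMG := Subgroup.subset_closure (by simp)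

/-- Every element of `IMG` is the section at the one-letter word `x` of an element of `IMG`
fixing that word. -/
theorem IMG_exists_section_letter (x : Bool) {g : Equiv.Perm (List Bool)} (hg : g ∈ IMG) :
    ∃ h ∈ IMG, ∀ w : List Bool, h (x :: w) = x :: g w := by
  have conj_mem {k} (hk : k ∈ IMG) : treeA * k * treeA ∈ IMG :=
    mul_mem (mul_mem treeA_mem_IMG hk) treeA_mem_IMG
  induction hg using Subgroup.closure_induction with
  | mem g hg =>
    obtain rfl | rfl | rfl := hg <;> cases x
    · exact ⟨treeB, treeB_mem_IMG, treeB_false_cons⟩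
    · exact ⟨_, conj_mem treeB_mem_IMG, fun w => by simp [treeA_cons, treeB_false_cons]⟩
    · exact ⟨treeC, treeC_mem_IMG, treeC_false_cons⟩
    · exact ⟨_, conj_mem treeC_mem_IMG, fun w => by simp [treeA_cons, treeC_false_cons]⟩
    · exact ⟨_, conj_mem treeB_mem_IMG, fun w => by simp [treeA_cons, treeB_true_cons]⟩
    · exact ⟨treeB, treeB_mem_IMG, treeB_true_cons⟩
  | one => exact ⟨1, one_mem _, fun _ => rfl⟩
  | mul g₁ g₂ _ _ ih₁ ih₂ =>
    obtain ⟨h₁, hm₁, hs₁⟩ := ih₁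
    obtain ⟨h₂, hm₂, hs₂⟩ := ih₂
    exact ⟨h₁ * h₂, mul_mem hm₁ hm₂, fun w => by simp [hs₁, hs₂]⟩
  | inv g _ ih =>
    obtain ⟨h, hm, hs⟩ := ih
    exact ⟨h⁻¹, inv_mem hm, fun w => by
      simp only [Equiv.Perm.inv_eq_iff_eq, hs]
      simp⟩

/-- `G` is self-replicating: for every vertex `u` and every `g ∈ G` there is
`h ∈ G` acting trivially above `u` whose section at `u` is `g`. -/
theorem IMG_self_replicating :
    ∀ (u : List Bool), ∀ g ∈ IMG, ∃ h ∈ IMG, ∀ w : List Bool, h (u ++ w) = u ++ g w := by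
  intro u g hg
  induction u with
  | nil => exact ⟨g, hg, fun _ => rfl⟩
  | cons x u ih =>
    obtain ⟨k, hk, hks⟩ := ih
    obtain ⟨h, hh, hhs⟩ := IMG_exists_section_letter x hk
    exact ⟨h, hh, fun w => by simp [hhs, hks]⟩
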